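/- arXiv:2404.08288 — 6 statements merged into one kernel-verified Lean document; each statement's English description precedes it below -/
import Mathlib

section
/- Fix a starting price s ∈ (0,1) and p₀ ∈ (s,1]. Suppose that for all p ∈ [s, p₀): b(p,s) < s, the individual-rationality condition c(s − b(p,s))·p − b(p,s) ≥ 0 holds, and b(p₀,s) = s. Then the function l(p) := (p − s) − [c(s − b(p,s))·p − b(p,s)] satisfies l'(p) = 1 − c(s − b(p,s)) + (g(p)/G(p))·[c(s − b(p,s))·p − b(p,s)] > 0 for all p ∈ [s, p₀), l(p₀) = 0, and consequently p₀ is the unique zero of l on [s, p₀]. -/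
/-- Uniqueness of the Dutch–English cutoff: the function
l(p) := (p − s) − [c(s − b(p,s))·p − b(p,s)] has positive derivative
1 − c(s − b(p,s)) + (g(p)/G(p))·[c(s − b(p,s))·p − b(p,s)] on [s, p₀),
l(p₀) = 0, and p₀ is the unique zero of l on [s, p₀]. -/
theorem stmt_2
    (n : ℕ) (hn : 2 ≤ n)
    (F f : ℝ → ℝ)
    (hF : ∀ v, HasDerivAt F (f v) v)
    (hf : ∀ v ∈ Set.Ioo (0:ℝ) 1, 0 < f v)
    (G g : ℝ → ℝ)
    (hG : ∀ v, G v = F v ^ (n - 1))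
    (hg : ∀ v, HasDerivAt G (g v) v)
    (c c' : ℝ → ℝ)
    (hc : ∀ t, HasDerivAt c (c' t) t)
    (hc0 : c 0 = 1)
    (hc' : ∀ t, -1 < c' t ∧ c' t < 0)
    (s : ℝ) (hs : s ∈ Set.Ioo (0:ℝ) 1)
    (b : ℝ → ℝ)
    (hb0 : b 0 = 0)
    (hbmono : StrictMonoOn b (Set.Icc 0 1))
    (hODE : ∀ v ∈ Set.Ioc (0:ℝ) 1,
      HasDerivAt b (g v / G v * (c (s - b v) * v - b v) / (1 + c' (s - b v) * v)) v)
    (p₀ : ℝ) (hp₀ : p₀ ∈ Set.Ioc s 1)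
    (hblt : ∀ p ∈ Set.Ico s p₀, b p < s)
    (hIR : ∀ p ∈ Set.Ico s p₀, 0 ≤ c (s - b p) * p - b p)
    (hbp₀ : b p₀ = s) :
    (∀ p ∈ Set.Ico s p₀,
      HasDerivAt (fun q => (q - s) - (c (s - b q) * q - b q))
        (1 - c (s - b p) + g p / G p * (c (s - b p) * p - b p)) p
      ∧ 0 < 1 - c (s - b p) + g p / G p * (c (s - b p) * p - b p))
    ∧ (p₀ - s) - (c (s - b p₀) * p₀ - b p₀) = 0
    ∧ (∀ p ∈ Set.Icc s p₀, (p - s) - (c (s - b p) * p - b p) = 0 → p = p₀) := by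
  have hs0 := hs.1
  obtain ⟨hsp₀, hp₀1⟩ := hp₀
  have hcanti : StrictAnti c := strictAnti_of_hasDerivAt_neg hc fun t => (hc' t).2
  have hslope : ∀ v ∈ Set.Ioc (0:ℝ) 1, 0 < 1 + c' (s - b v) * v := by
    rintro v ⟨hv0, hv1⟩
    nlinarith [mul_pos (neg_lt_iff_pos_add.mp (hc' (s - b v)).1) hv0]
  have hderiv : ∀ p ∈ Set.Ioc (0:ℝ) 1,
      HasDerivAt (fun q => (q - s) - (c (s - b q) * q - b q))
        (1 - c (s - b p) + g p / G p * (c (s - b p) * p - b p)) p := by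
    intro p hp
    have hb := hODE p hp
    have hcb := (hc (s - b p)).comp p (hb.const_sub s)
    have hl := ((hasDerivAt_id p).sub_const s).sub ((hcb.mul (hasDerivAt_id p)).sub hb)
    refine hl.congr_deriv ?_
    have hne := (hslope p hp).ne'
    simp only [Function.comp_apply, id_eq]
    linear_combination mul_div_cancel₀ (g p / G p * (c (s - b p) * p - b p)) hne
  have hpos : ∀ p ∈ Set.Ico s p₀,
      0 < 1 - c (s - b p) + g p / G p * (c (s - b p) * p - b p) := by
    intro p hp
    have hp0 : 0 < p := hs0.trans_le hp.1
    have hp1 : p < 1 := hp.2.trans_le hp₀1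
    have hc1 : c (s - b p) < 1 := hc0 ▸ hcanti (sub_pos.mpr (hblt p hp))
    have hb := hODE p ⟨hp0, hp1.le⟩
    have hb_nonneg := hb.hasDerivWithinAt.nonneg_of_monotoneOn
      (uniqueDiffOn_Icc zero_lt_one p ⟨hp0.le, hp1.le⟩).accPt hbmono.monotoneOn
    have hnum := mul_nonneg hb_nonneg (hslope p ⟨hp0, hp1.le⟩).le
    rw [div_mul_cancel₀ _ (hslope p ⟨hp0, hp1.le⟩).ne'] at hnum
    linarith
  have hzero : (p₀ - s) - (c (s - b p₀) * p₀ - b p₀) = 0 := by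
    simp [hbp₀, hc0]
  have hmono : StrictMonoOn (fun q => (q - s) - (c (s - b q) * q - b q)) (Set.Icc s p₀) := by
    refine strictMonoOn_of_hasDerivWithinAt_pos (convex_Icc s p₀)
      (f' := fun p => 1 - c (s - b p) + g p / G p * (c (s - b p) * p - b p)) ?_ ?_ ?_
    · exact fun p hp =>
        (hderiv p ⟨hs0.trans_le hp.1, hp.2.trans hp₀1⟩).continuousAt.continuousWithinAt
    · intro p hp
      rw [interior_Icc] at hp
      exact (hderiv p ⟨hs0.trans hp.1, hp.2.le.trans hp₀1⟩).hasDerivWithinAt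
    · intro p hp
      rw [interior_Icc] at hp
      exact hpos p ⟨hp.1.le, hp.2⟩
  refine ⟨fun p hp => ⟨hderiv p ⟨hs0.trans_le hp.1, hp.2.le.trans hp₀1⟩, hpos p hp⟩, hzero, ?_⟩
  intro p hp hlp
  exact hmono.injOn hp (Set.right_mem_Icc.mpr hsp₀.le) (hlp.trans hzero.symm)
end

section
/- Let v ∈ (0,1] and let m(v,·) be differentiable in s and satisfy the English-phase leaving condition c(m(v,s) − s)·v − m(v,s) = 0. If c'(t) < 0 for all t, then ∂m(v,s)/∂s = − c'(m(v,s) − s)·v / (1 − c'(m(v,s) − s)·v) and 0 < ∂m(v,s)/∂s < 1. If instead c(t) = 1 for all t (no time cost), then m(v,s) = v and ∂m(v,s)/∂s = 0. In particular, 0 ≤ ∂m(v,s)/∂s < 1 always, with equality to 0 only in the no-time-cost case. -/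
/-- Lemma 3 of the paper: properties of ∂m(v,s)/∂s for the
English-phase leaving function defined by c(m(v,s) − s)·v − m(v,s) = 0. -/
theorem stmt_4
    (c c' : ℝ → ℝ)
    (hc : ∀ t, HasDerivAt c (c' t) t)
    (hc0 : c 0 = 1)
    (hc'gt : ∀ t, -1 < c' t)
    (v : ℝ) (hv : v ∈ Set.Ioc (0:ℝ) 1)
    (m m' : ℝ → ℝ)
    (hm : ∀ s, HasDerivAt m (m' s) s)
    (heq : ∀ s, c (m s - s) * v - m s = 0) :
    ((∀ t, c' t < 0) → ∀ s,
        m' s = -c' (m s - s) * v / (1 - c' (m s - s) * v)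
        ∧ 0 < m' s ∧ m' s < 1)
    ∧ ((∀ t, c t = 1) → ∀ s, m s = v ∧ m' s = 0)
    ∧ (((∀ t, c' t < 0) ∨ (∀ t, c t = 1)) → ∀ s,
        0 ≤ m' s ∧ m' s < 1 ∧ (m' s = 0 → ∀ t, c t = 1)) := by
  have key : ∀ s, c' (m s - s) * (m' s - 1) * v - m' s = 0 := by
    intro s
    have hg : HasDerivAt (fun s => m s - s) (m' s - 1) s := (hm s).sub (hasDerivAt_id' s)
    have hF : HasDerivAt (fun s => c (m s - s) * v - m s)
        (c' (m s - s) * (m' s - 1) * v - m' s) s :=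
      ((HasDerivAt.comp (h := fun s => m s - s) s (hc (m s - s)) hg).mul_const v).sub (hm s)
    have hzero : (fun s => c (m s - s) * v - m s) = fun _ => (0 : ℝ) := funext heq
    rw [hzero] at hF
    exact hF.unique (hasDerivAt_const s 0)
  have hneg : (∀ t, c' t < 0) → ∀ s,
      m' s = -c' (m s - s) * v / (1 - c' (m s - s) * v) ∧ 0 < m' s ∧ m' s < 1 := by
    intro h s
    have hnum : 0 < -c' (m s - s) * v := mul_pos (neg_pos.mpr (h _)) hv.1
    have hden : 0 < 1 - c' (m s - s) * v := by linarith
    have hformula : m' s = -c' (m s - s) * v / (1 - c' (m s - s) * v) := by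
      rw [eq_div_iff hden.ne']
      linarith [key s]
    refine ⟨hformula, ?_, ?_⟩
    · rw [hformula]
      exact div_pos hnum hden
    · rw [hformula, div_lt_one hden]
      linarith
  have hone : (∀ t, c t = 1) → ∀ s, m s = v ∧ m' s = 0 := by
    intro h
    have hmv : ∀ s, m s = v := fun s => by
      have := heq s
      rw [h] at this
      linarith
    refine fun s => ⟨hmv s, ?_⟩
    have hd := hm s
    rw [show m = fun _ => v from funext hmv] at hd
    exact hd.unique (hasDerivAt_const s v)
  refine ⟨hneg, hone, ?_⟩
  rintro (h | h) s
  · obtain ⟨-, hpos, hlt⟩ := hneg h s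
    exact ⟨hpos.le, hlt, fun h0 => absurd h0 hpos.ne'⟩
  · have h0 := (hone h s).2
    exact ⟨h0.ge, h0.trans_lt one_pos, fun _ => h⟩
end

section
/- Let s ∈ [0,1] and let m(·,s) be differentiable in v and satisfy the English-phase leaving condition c(m(v,s) − s)·v − m(v,s) = 0 for all v. If c(t) > 0 and −1 < c'(t) ≤ 0 for all t, then ∂m(v,s)/∂v = c(m(v,s) − s) / (1 − c'(m(v,s) − s)·v) > 0 for all v ∈ [0,1]; that is, the English-phase leaving function is strictly increasing in the bidder's item value. -/
/-- the English-phase leaving function is strictly increasing in the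
bidder's value: ∂m/∂v = c(m − s)/(1 − c'(m − s)·v) > 0. -/
theorem stmt_5
    (c c' : ℝ → ℝ)
    (hc : ∀ t, HasDerivAt c (c' t) t)
    (hc0 : c 0 = 1)
    (hcpos : ∀ t, 0 < c t)
    (hc' : ∀ t, -1 < c' t ∧ c' t ≤ 0)
    (s : ℝ) (hs : s ∈ Set.Icc (0:ℝ) 1)
    (m m' : ℝ → ℝ)
    (hm : ∀ v, HasDerivAt m (m' v) v)
    (heq : ∀ v, c (m v - s) * v - m v = 0) :
    ∀ v ∈ Set.Icc (0:ℝ) 1,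
      m' v = c (m v - s) / (1 - c' (m v - s) * v) ∧ 0 < m' v := by
  intro v hv
  have hcomp : HasDerivAt (fun x => c (m x - s)) (c' (m v - s) * m' v) v :=
    (hc (m v - s)).comp v ((hm v).sub_const s)
  have hderiv : HasDerivAt (fun x => c (m x - s) * x - m x)
      (c' (m v - s) * m' v * v + c (m v - s) * 1 - m' v) v :=
    (hcomp.mul (hasDerivAt_id v)).sub (hm v)
  have hzero : HasDerivAt (fun x => c (m x - s) * x - m x) 0 v := by
    simpa only [heq] using hasDerivAt_const v (0 : ℝ)
  have hlin := hderiv.unique hzero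
  have hden : 0 < 1 - c' (m v - s) * v := by
    linarith [mul_nonpos_of_nonpos_of_nonneg (hc' (m v - s)).2 hv.1]
  have hformula : m' v = c (m v - s) / (1 - c' (m v - s) * v) := by
    rw [eq_div_iff hden.ne']
    linarith
  exact ⟨hformula, hformula ▸ div_pos (hcpos _) hden⟩
end

section
/- Fix s₁, s₂ ∈ [0,1] with s₁ < s₂. For i = 1,2 let b(·, sᵢ) be a C¹, strictly increasing solution on [0,1] of the ODE ∂b/∂v = (g(v)/G(v)) · (c(sᵢ − b)·v − b)/(1 + c'(sᵢ − b)·v) with b(0, sᵢ) = 0 and with c(sᵢ − b(v,sᵢ))·v − b(v,sᵢ) > 0 for all v ∈ (0,1]. If c'(t) < 0, c''(t) ≥ 0 and c'(t) > −1 for all t, then b(v, s₁) > b(v, s₂) for every v ∈ (0,1]; that is, the Dutch-phase bidding function is strictly decreasing in the starting price. -/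
open Set

/-- If `G > 0`, the first-order condition of the bidding problem is equivalent to the envelope
condition: the interim payoff `G v * (c (s - b v) * v - b v)` has derivative
`G v * c (s - b v)`. -/
theorem hasDerivAt_interim_payoff {G g c c' b : ℝ → ℝ} {s v : ℝ}
    (hG : HasDerivAt G (g v) v) (hGpos : 0 < G v)
    (hc : ∀ t, HasDerivAt c (c' t) t) (hden : 0 < 1 + c' (s - b v) * v)
    (hb : HasDerivAt b (g v / G v * (c (s - b v) * v - b v) / (1 + c' (s - b v) * v)) v) :
    HasDerivAt (fun x => G x * (c (s - b x) * x - b x)) (G v * c (s - b v)) v := by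
  have hfoc : G v * (g v / G v * (c (s - b v) * v - b v) / (1 + c' (s - b v) * v))
      * (1 + c' (s - b v) * v) = g v * (c (s - b v) * v - b v) := by
    have := hGpos.ne'
    rw [mul_assoc, div_mul_cancel₀ _ hden.ne']
    field_simp
  generalize g v / G v * (c (s - b v) * v - b v) / (1 + c' (s - b v) * v) = b' at hb hfoc
  have hcomp : HasDerivAt (fun x => c (s - b x)) _ v :=
    (hc (s - b v)).comp v (hb.const_sub s)
  refine (hG.mul ((hcomp.mul (hasDerivAt_id v)).sub hb)).congr_deriv ?_
  simp only [Pi.sub_apply, Pi.mul_apply, id]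
  linear_combination -hfoc

/-- If the `k`-th power of a strictly increasing function `F` has nonnegative logarithmic
derivative, then both `F ^ k` and its logarithmic derivative are positive. -/
theorem logDeriv_pow_pos {k : ℕ} (hk : k ≠ 0) {F f G g : ℝ → ℝ}
    (hF : ∀ v, HasDerivAt F (f v) v) (hf : ∀ v ∈ Ioo (0:ℝ) 1, 0 < f v)
    (hG : ∀ v, G v = F v ^ k) (hg : ∀ v, HasDerivAt G (g v) v)
    (h : ∀ v ∈ Ioo (0:ℝ) 1, 0 ≤ g v / G v) {v : ℝ} (hv : v ∈ Ioo (0:ℝ) 1) :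
    0 < G v ∧ 0 < g v / G v := by
  have hmono : StrictMonoOn F (Icc 0 1) := by
    refine strictMonoOn_of_deriv_pos (convex_Icc 0 1)
      (fun x _ => (hF x).continuousAt.continuousWithinAt) fun x hx => ?_
    rw [interior_Icc] at hx
    rw [(hF x).deriv]
    exact hf x hx
  have hquot : ∀ x, F x ≠ 0 → g x / G x = k * f x / F x := by
    intro x hx
    have hgx : g x = k * F x ^ (k - 1) * f x := by
      have h1 : HasDerivAt G (k * F x ^ (k - 1) * f x) x :=
        ((hF x).pow k).congr_of_eventuallyEq (Filter.Eventually.of_forall hG)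
      exact (hg x).unique h1
    obtain ⟨m, rfl⟩ := Nat.exists_eq_succ_of_ne_zero hk
    rw [hgx, hG]
    simp only [Nat.succ_eq_add_one, Nat.add_sub_cancel]
    field_simp
    ring
  have hkpos : (0:ℝ) < k := by exact_mod_cast Nat.pos_of_ne_zero hk
  have hFpos : 0 < F v := by
    by_contra! hle
    have hw : v / 2 ∈ Ioo (0:ℝ) 1 := ⟨by linarith [hv.1], by linarith [hv.1, hv.2]⟩
    have hlt : F (v / 2) < F v :=
      hmono (Ioo_subset_Icc_self hw) (Ioo_subset_Icc_self hv) (by linarith [hv.1])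
    have hneg : F (v / 2) < 0 := hlt.trans_le hle
    have h0 := h _ hw
    rw [hquot _ hneg.ne] at h0
    exact absurd h0 (not_le.2 (div_neg_of_pos_of_neg (mul_pos hkpos (hf _ hw)) hneg))
  refine ⟨hG v ▸ pow_pos hFpos k, ?_⟩
  rw [hquot v hFpos.ne']
  exact div_pos (mul_pos hkpos (hf v hv)) hFpos

/-- A function continuous on `[0, 1]` and positive at `0` is positive on `[0, 1]` if positivity
propagates from `[0, x)` to `x`. -/
theorem pos_on_Icc_of_propagates {D : ℝ → ℝ} (hD : ContinuousOn D (Icc 0 1))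
    (hstep : ∀ x ∈ Icc (0:ℝ) 1, (∀ y ∈ Ico 0 x, 0 < D y) → 0 < D x) :
    ∀ x ∈ Icc (0:ℝ) 1, 0 < D x := by
  by_contra! hne
  obtain ⟨z, hz, hDz⟩ := hne
  have hclosed : IsClosed (Icc (0:ℝ) 1 ∩ D ⁻¹' Iic 0) :=
    hD.preimage_isClosed_of_isClosed isClosed_Icc isClosed_Iic
  have hbdd : BddBelow (Icc (0:ℝ) 1 ∩ D ⁻¹' Iic 0) := ⟨0, fun y hy => hy.1.1⟩
  have hmem := hclosed.csInf_mem ⟨z, hz, hDz⟩ hbdd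
  refine absurd (hstep _ hmem.1 fun y hy => ?_) (not_lt.2 hmem.2)
  by_contra! hle
  exact absurd hy.2 (not_lt.2 (csInf_le hbdd ⟨⟨hy.1, hy.2.le.trans hmem.1.2⟩, hle⟩))


/-- Lemma 5 of the paper: with a strictly decreasing convex time cost,
the Dutch-phase bidding function is strictly decreasing in the starting price:
if s₁ < s₂ then b(v,s₁) > b(v,s₂) for all v ∈ (0,1]. -/
theorem stmt_8
    (n : ℕ) (hn : 2 ≤ n)
    (F f : ℝ → ℝ)
    (hF : ∀ v, HasDerivAt F (f v) v)
    (hf : ∀ v ∈ Set.Ioo (0:ℝ) 1, 0 < f v)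
    (G g : ℝ → ℝ)
    (hG : ∀ v, G v = F v ^ (n - 1))
    (hg : ∀ v, HasDerivAt G (g v) v)
    (c c' c'' : ℝ → ℝ)
    (hc : ∀ t, HasDerivAt c (c' t) t)
    (hc'd : ∀ t, HasDerivAt c' (c'' t) t)
    (hc0 : c 0 = 1)
    (hc'neg : ∀ t, c' t < 0)
    (hc'' : ∀ t, 0 ≤ c'' t)
    (hc'gt : ∀ t, -1 < c' t)
    (s₁ s₂ : ℝ) (hs₁ : s₁ ∈ Set.Icc (0:ℝ) 1) (hs₂ : s₂ ∈ Set.Icc (0:ℝ) 1)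
    (hss : s₁ < s₂)
    (b₁ b₂ : ℝ → ℝ)
    (hb₁0 : b₁ 0 = 0) (hb₂0 : b₂ 0 = 0)
    (hb₁c : ContinuousOn b₁ (Set.Icc 0 1)) (hb₂c : ContinuousOn b₂ (Set.Icc 0 1))
    (hb₁mono : StrictMonoOn b₁ (Set.Icc 0 1)) (hb₂mono : StrictMonoOn b₂ (Set.Icc 0 1))
    (hODE₁ : ∀ v ∈ Set.Ioc (0:ℝ) 1,
      HasDerivAt b₁ (g v / G v * (c (s₁ - b₁ v) * v - b₁ v) / (1 + c' (s₁ - b₁ v) * v)) v)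
    (hODE₂ : ∀ v ∈ Set.Ioc (0:ℝ) 1,
      HasDerivAt b₂ (g v / G v * (c (s₂ - b₂ v) * v - b₂ v) / (1 + c' (s₂ - b₂ v) * v)) v)
    (hpos₁ : ∀ v ∈ Set.Ioc (0:ℝ) 1, 0 < c (s₁ - b₁ v) * v - b₁ v)
    (hpos₂ : ∀ v ∈ Set.Ioc (0:ℝ) 1, 0 < c (s₂ - b₂ v) * v - b₂ v) :
    ∀ v ∈ Set.Ioc (0:ℝ) 1, b₂ v < b₁ v := by
  have hanti : StrictAnti c := strictAnti_of_deriv_neg fun t => by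
    rw [(hc t).deriv]; exact hc'neg t
  have hmono : Monotone c' := monotone_of_deriv_nonneg (fun t => (hc'd t).differentiableAt)
    fun t => by rw [(hc'd t).deriv]; exact hc'' t
  have hden : ∀ t, ∀ v ∈ Ioc (0:ℝ) 1, 0 < 1 + c' t * v := fun t v hv => by
    nlinarith [hc'gt t, hc'neg t, hv.1, hv.2]
  have hquot : ∀ v ∈ Ioo (0:ℝ) 1, 0 ≤ g v / G v := by
    intro v hv
    have hv' : v ∈ Ioc (0:ℝ) 1 := Ioo_subset_Ioc_self hv
    have hnn := hb₁mono.monotoneOn.derivWithin_nonneg (x := v)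
    rw [((hODE₁ v hv').hasDerivWithinAt).derivWithin
      (uniqueDiffOn_Icc zero_lt_one v (Ioo_subset_Icc_self hv))] at hnn
    by_contra! hneg
    exact absurd hnn (not_le.2 (div_neg_of_neg_of_pos
      (mul_neg_of_neg_of_pos hneg (hpos₁ v hv')) (hden _ v hv')))
  have hGg : ∀ v ∈ Ioo (0:ℝ) 1, 0 < G v ∧ 0 < g v / G v := fun v hv =>
    logDeriv_pow_pos (by omega) hF hf hG hg hquot hv
  have hccont : Continuous c := continuous_iff_continuousAt.2 fun t => (hc t).continuousAt
  have hGcont : Continuous G := continuous_iff_continuousAt.2 fun t => (hg t).continuousAt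
  have hUcont : ∀ (s : ℝ) (b : ℝ → ℝ), ContinuousOn b (Icc 0 1) →
      ContinuousOn (fun x => G x * (c (s - b x) * x - b x)) (Icc 0 1) := fun s b hb =>
    hGcont.continuousOn.mul (((hccont.comp_continuousOn (continuousOn_const.sub hb)).mul
      continuousOn_id).sub hb)
  have hgap : ∀ x ∈ Icc (0:ℝ) 1, (∀ y ∈ Ico 0 x, 0 < s₂ - s₁ + (b₁ y - b₂ y)) →
      StrictMonoOn (fun y => b₁ y - b₂ y) (Icc 0 x) := by
    intro x hx hpos
    have hsub : Icc 0 x ⊆ Icc (0:ℝ) 1 := Icc_subset_Icc_right hx.2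
    have hUmono : StrictMonoOn (fun y => G y * (c (s₁ - b₁ y) * y - b₁ y)
        - G y * (c (s₂ - b₂ y) * y - b₂ y)) (Icc 0 x) := by
      refine strictMonoOn_of_deriv_pos (convex_Icc 0 x)
        (((hUcont s₁ b₁ hb₁c).sub (hUcont s₂ b₂ hb₂c)).mono hsub) fun y hy => ?_
      rw [interior_Icc] at hy
      have hy1 : y ∈ Ioo (0:ℝ) 1 := ⟨hy.1, hy.2.trans_le hx.2⟩
      have hy' : y ∈ Ioc (0:ℝ) 1 := Ioo_subset_Ioc_self hy1
      have hGy := (hGg y hy1).1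
      have hd := (hasDerivAt_interim_payoff (hg y) hGy hc (hden _ y hy') (hODE₁ y hy')).sub
        (hasDerivAt_interim_payoff (hg y) hGy hc (hden _ y hy') (hODE₂ y hy'))
      refine hd.deriv.symm ▸ sub_pos.2 (mul_lt_mul_of_pos_left (hanti ?_) hGy)
      linarith [hpos y ⟨hy.1.le, hy.2⟩]
    refine strictMonoOn_of_deriv_pos (convex_Icc 0 x)
      ((hb₁c.sub hb₂c).mono hsub) fun y hy => ?_
    rw [interior_Icc] at hy
    have hy1 : y ∈ Ioo (0:ℝ) 1 := ⟨hy.1, hy.2.trans_le hx.2⟩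
    have hy' : y ∈ Ioc (0:ℝ) 1 := Ioo_subset_Ioc_self hy1
    obtain ⟨hGy, hgGy⟩ := hGg y hy1
    have hU := hUmono ⟨le_rfl, hx.1⟩ (Ioo_subset_Icc_self hy) hy.1
    simp only [hb₁0, hb₂0, mul_zero, sub_zero] at hU
    have hu : c (s₂ - b₂ y) * y - b₂ y < c (s₁ - b₁ y) * y - b₁ y :=
      lt_of_mul_lt_mul_left (sub_pos.1 hU) hGy.le
    have hle : 1 + c' (s₁ - b₁ y) * y ≤ 1 + c' (s₂ - b₂ y) * y := by
      have := hmono (show s₁ - b₁ y ≤ s₂ - b₂ y by linarith [hpos y ⟨hy.1.le, hy.2⟩])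
      linarith [mul_le_mul_of_nonneg_right this hy.1.le]
    refine ((hODE₁ y hy').sub (hODE₂ y hy')).deriv.symm ▸ sub_pos.2 ?_
    exact div_lt_div₀ (mul_lt_mul_of_pos_left hu hgGy) hle
      (mul_pos hgGy (hpos₁ y hy')).le (hden _ y hy')
  have hpos : ∀ x ∈ Icc (0:ℝ) 1, 0 < s₂ - s₁ + (b₁ x - b₂ x) := by
    refine pos_on_Icc_of_propagates (continuousOn_const.add (hb₁c.sub hb₂c)) fun x hx h => ?_
    have h0 := (hgap x hx h).monotoneOn ⟨le_rfl, hx.1⟩ ⟨hx.1, le_rfl⟩ hx.1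
    simp only [hb₁0, hb₂0, sub_zero] at h0
    linarith
  intro v hv
  have h0 := hgap v (Ioc_subset_Icc_self hv)
    (fun y hy => hpos y ⟨hy.1, hy.2.le.trans hv.2⟩) ⟨le_rfl, hv.1.le⟩ ⟨hv.1.le, le_rfl⟩ hv.1
  simp only [hb₁0, hb₂0, sub_zero] at h0
  linarith
end

section
/- Suppose there is no time cost, i.e. c(t) = 1 for all t, so that the English-phase leaving function is m(x,s) = x and the Dutch-phase bidding function is b(v) = (1/G(v)) ∫₀^v x g(x) dx (independent of s). Then for every cutoff p ∈ (0,1), setting s := b(p), the auctioneer's expected utility ∫₀^p b(v) d(F^n(v)) + ∫_p^1 [ ∫₀^p s·h(v,x) dx + ∫_p^v x·h(v,x) dx ] dv equals ∫₀^1 [ v − (1 − F(v))/f(v) ] d(F^n(v)); in particular it does not depend on p (Payoff Equivalence Principle). -/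
open intervalIntegral

open MeasureTheory Set

/-- Integration by parts for the numerator of the Dutch-phase bid. -/
lemma integral_id_mul_deriv_eq {G g : ℝ → ℝ} {a : ℝ}
    (hG : ∀ v, HasDerivAt G (g v) v) (hg : IntervalIntegrable g volume 0 a) :
    ∫ x in (0:ℝ)..a, x * g x = a * G a - ∫ x in (0:ℝ)..a, G x := by
  have hGc : Continuous G := continuous_iff_continuousAt.2 fun v => (hG v).continuousAt
  have h := integral_mul_deriv_eq_deriv_mul (a := 0) (b := a) (u := id) (u' := fun _ => 1)
    (fun x _ => hasDerivAt_id x) (fun x _ => hG x) (by simp) hg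
  simpa using h

/-- The expected revenue of the pure Dutch auction, up to the factor `n`, in terms of the
antiderivative of `G`. -/
lemma integral_deriv_mul_integral_eq {F f G : ℝ → ℝ} (hF : ∀ v, HasDerivAt F (f v) v)
    (hf : IntervalIntegrable f volume 0 1) (hF1 : F 1 = 1) (hG : Continuous G) :
    ∫ v in (0:ℝ)..1, f v * ∫ x in (0:ℝ)..v, G x = ∫ v in (0:ℝ)..1, (1 - F v) * G v := by
  have hd : ∀ v, HasDerivAt (fun v => ∫ x in (0:ℝ)..v, G x) (G v) v := fun v =>
    integral_hasDerivAt_right (hG.intervalIntegrable _ _)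
      hG.aestronglyMeasurable.stronglyMeasurableAtFilter hG.continuousAt
  have h := integral_mul_deriv_eq_deriv_mul (a := 0) (b := 1) (u := fun v => 1 - F v)
    (u' := fun v => -f v) (fun x _ => (hF x).const_sub 1) (fun x _ => hd x) hf.neg
    (hG.intervalIntegrable _ _)
  simp [hF1] at h
  exact h.symm

/-- Proposition 1 of the paper, Payoff Equivalence: with no time cost,
for every cutoff p ∈ (0,1) with starting price s = b(p), the auctioneer's expected
utility in the Istanbul Flower Auction equals ∫₀¹ [v − (1 − F(v))/f(v)] d(Fⁿ(v)). -/
theorem stmt_9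
    (n : ℕ) (hn : 2 ≤ n)
    (F f : ℝ → ℝ)
    (hF : ∀ v, HasDerivAt F (f v) v)
    (hf : ∀ v ∈ Set.Ioo (0:ℝ) 1, 0 < f v)
    (hF0 : F 0 = 0) (hF1 : F 1 = 1)
    (G g : ℝ → ℝ)
    (hG : ∀ v, G v = F v ^ (n - 1))
    (hg : ∀ v, HasDerivAt G (g v) v)
    (h : ℝ → ℝ → ℝ)
    (hh : ∀ v x, h v x = n * (n - 1) * f v * f x * F x ^ (n - 2))
    (b : ℝ → ℝ)
    (hb : ∀ v, b v = (∫ x in (0:ℝ)..v, x * g x) / G v)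
    (p : ℝ) (hp : p ∈ Set.Ioo (0:ℝ) 1) :
    (∫ v in (0:ℝ)..p, b v * (n * F v ^ (n - 1) * f v))
      + (∫ v in p..(1:ℝ),
          ((∫ x in (0:ℝ)..p, b p * h v x) + ∫ x in p..v, x * h v x))
      = ∫ v in (0:ℝ)..(1:ℝ), (v - (1 - F v) / f v) * (n * F v ^ (n - 1) * f v) := by
  obtain ⟨k, rfl⟩ : ∃ k, n = k + 2 := ⟨n - 2, by omega⟩
  have hk1 : k + 2 - 1 = k + 1 := rfl
  have hk2 : k + 2 - 2 = k := rfl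
  rw [hk1] at hG
  simp only [hk2] at hh
  rw [hk1]
  push_cast at hh ⊢
  have hFc : Continuous F := continuous_iff_continuousAt.2 fun v => (hF v).continuousAt
  have hGc : Continuous G := continuous_iff_continuousAt.2 fun v => (hg v).continuousAt
  have hfi : IntervalIntegrable f volume 0 1 :=
    intervalIntegrable_deriv_of_nonneg hFc.continuousOn (fun x _ => hF x)
      (fun x hx => (hf x (by simpa using hx)).le)
  have hfi' : ∀ {a c : ℝ}, a ∈ Icc (0:ℝ) 1 → c ∈ Icc (0:ℝ) 1 →
      IntervalIntegrable f volume a c := fun ha hc =>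
    hfi.mono_set (uIcc_subset_uIcc (by simpa using ha) (by simpa using hc))
  have hFm : StrictMonoOn F (Icc 0 1) :=
    strictMonoOn_of_deriv_pos (convex_Icc 0 1) hFc.continuousOn
      (fun x hx => by rw [interior_Icc] at hx; rw [(hF x).deriv]; exact hf x hx)
  have hGne : ∀ v ∈ Ioc (0:ℝ) 1, G v ≠ 0 := fun v hv => by
    have := hFm (left_mem_Icc.2 zero_le_one) ⟨hv.1.le, hv.2⟩ hv.1
    rw [hF0] at this
    rw [hG]
    positivity
  have hgeq : g = fun v => (k + 1) * F v ^ k * f v := by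
    funext v
    have h1 := (hF v).pow (k + 1)
    have h2 : G = F ^ (k + 1) := funext hG
    have := (hg v).unique (h2 ▸ h1)
    simpa using this
  have hgi : ∀ {a c : ℝ}, a ∈ Icc (0:ℝ) 1 → c ∈ Icc (0:ℝ) 1 →
      IntervalIntegrable g volume a c := fun ha hc => by
    rw [hgeq]
    exact (hfi' ha hc).continuousOn_mul (by fun_prop)
  have h0 : (0:ℝ) ∈ Icc (0:ℝ) 1 := by simp
  have h1 : (1:ℝ) ∈ Icc (0:ℝ) 1 := by simp
  have hpI : p ∈ Icc (0:ℝ) 1 := ⟨hp.1.le, hp.2.le⟩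
  set H : ℝ → ℝ := fun v => ∫ x in (0:ℝ)..v, G x with hH
  have hHc : Continuous H := continuous_primitive (fun a c => hGc.intervalIntegrable a c) 0
  have hB : ∀ v ∈ Icc (0:ℝ) 1, ∫ x in (0:ℝ)..v, x * g x = v * G v - H v := fun v hv =>
    integral_id_mul_deriv_eq hg (hgi h0 hv)
  have hbG : ∀ v ∈ Ioc (0:ℝ) 1, b v * G v = v * G v - H v := fun v hv => by
    rw [hb, div_mul_cancel₀ _ (hGne v hv), hB v ⟨hv.1.le, hv.2⟩]
  have hxg : ∀ {a c : ℝ}, a ∈ Icc (0:ℝ) 1 → c ∈ Icc (0:ℝ) 1 →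
      IntervalIntegrable (fun x => x * g x) volume a c := fun ha hc =>
    (hgi ha hc).continuousOn_mul continuousOn_id
  have hdutch : ∫ v in (0:ℝ)..p, b v * ((k + 2) * F v ^ (k + 1) * f v)
      = ∫ v in (0:ℝ)..p, (k + 2) * (f v * (v * G v - H v)) := by
    refine integral_congr_ae (.of_forall fun v hv => ?_)
    rw [uIoc_of_le hp.1.le] at hv
    rw [← hbG v ⟨hv.1, hv.2.trans hp.2.le⟩, hG]
    ring
  have henglish : ∫ v in p..(1:ℝ),
        ((∫ x in (0:ℝ)..p, b p * h v x) + ∫ x in p..v, x * h v x)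
      = ∫ v in p..(1:ℝ), (k + 2) * (f v * (v * G v - H v)) := by
    refine integral_congr_ae (.of_forall fun v hv => ?_)
    rw [uIoc_of_le hp.2.le] at hv
    have hvI : v ∈ Icc (0:ℝ) 1 := ⟨(hp.1.trans hv.1).le, hv.2⟩
    have e1 : ∀ x, b p * h v x = (b p * ((k + 2) * f v)) * g x := fun x => by
      rw [hh, hgeq]; ring
    have e2 : ∀ x, x * h v x = ((k + 2) * f v) * (x * g x) := fun x => by
      rw [hh, hgeq]; ring
    simp only [e1, e2, intervalIntegral.integral_const_mul]
    rw [integral_eq_sub_of_hasDerivAt (fun x _ => hg x) (hgi h0 hpI),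
      ← integral_interval_sub_left (hxg h0 hvI) (hxg h0 hpI), hB v hvI, hB p hpI,
      ← hbG p ⟨hp.1, hp.2.le⟩, hG 0, hF0]
    ring
  have hrhs : ∫ v in (0:ℝ)..(1:ℝ),
        (v - (1 - F v) / f v) * ((k + 2) * F v ^ (k + 1) * f v)
      = ∫ v in (0:ℝ)..(1:ℝ), (k + 2) * (f v * (v * G v) - (1 - F v) * G v) := by
    simp only [integral_of_le zero_le_one, integral_Ioc_eq_integral_Ioo]
    refine setIntegral_congr_fun measurableSet_Ioo fun v hv => ?_
    have := (hf v hv).ne'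
    simp only [hG]
    field_simp
  have hfH : ∀ {u : ℝ → ℝ} {a c : ℝ}, Continuous u → a ∈ Icc (0:ℝ) 1 → c ∈ Icc (0:ℝ) 1 →
      IntervalIntegrable (fun v => f v * u v) volume a c := fun hu ha hc =>
    (hfi' ha hc).mul_continuousOn hu.continuousOn
  have hvc : Continuous fun v => v * G v := by fun_prop
  have hint : ∀ {a c : ℝ}, a ∈ Icc (0:ℝ) 1 → c ∈ Icc (0:ℝ) 1 →
      IntervalIntegrable (fun v => (k + 2) * (f v * (v * G v - H v))) volume a c :=
    fun ha hc => (hfH (hvc.sub hHc) ha hc).const_mul _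
  rw [hdutch, henglish, integral_add_adjacent_intervals (hint h0 hpI) (hint hpI h1), hrhs,
    intervalIntegral.integral_const_mul, intervalIntegral.integral_const_mul]
  congr 1
  simp only [mul_sub (f _)]
  rw [integral_sub (hfH hvc h0 h1) (hfH hHc h0 h1),
    integral_sub (hfH hvc h0 h1) (Continuous.intervalIntegrable (by fun_prop) _ _),
    integral_deriv_mul_integral_eq hF hfi hF1 hGc]
end

section
/- Let b : [0,1] × [0,1] → ℝ be C² with equal mixed second partial derivatives, such that for each s, b(0,s) = 0 and b(·,s) solves the ODE ∂b/∂v = (g(v)/G(v))·(c(s−b)·v − b)/(1 + c'(s−b)·v) on (0,1]. Define w(v,s) := G(v)·( c'(s − b(v,s))·v − [1 + c'(s − b(v,s))·v]·∂b(v,s)/∂s ). Then ∂w(v,s)/∂v = G(v)·c'(s − b(v,s))·(1 − ∂b(v,s)/∂s) for all v ∈ (0,1]. In particular, if c'(t) < 0 for all t and ∂b/∂s < 1, then w(·,s) is strictly decreasing on (0,1); since w(0,s) = 0, it follows that ∫₀^1 w(v,s) dF(v) < 0. -/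
open intervalIntegral

theorem pos_of_hasDerivAt_pos_of_zero {F f : ℝ → ℝ} (hF : ∀ v, HasDerivAt F (f v) v)
    (hf : ∀ v ∈ Set.Ioo (0 : ℝ) 1, 0 < f v) (hF0 : F 0 = 0) {v : ℝ}
    (hv : v ∈ Set.Ioc (0 : ℝ) 1) : 0 < F v := by
  have hmono : StrictMonoOn F (Set.Icc 0 1) := by
    refine strictMonoOn_of_deriv_pos (convex_Icc 0 1)
      (fun x _ => (hF x).continuousAt.continuousWithinAt) fun x hx => ?_
    rw [interior_Icc] at hx
    rw [(hF x).deriv]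
    exact hf x hx
  simpa [hF0] using hmono (Set.left_mem_Icc.2 zero_le_one) (Set.Ioc_subset_Icc_self hv) hv.1

/-- A continuous function which is negative on `(0, 1)` has negative integral against a density. -/
theorem integral_mul_density_neg {F f w : ℝ → ℝ} (hF : ∀ v, HasDerivAt F (f v) v)
    (hf : ∀ v ∈ Set.Ioo (0 : ℝ) 1, 0 < f v) (hw : ContinuousOn w (Set.Icc 0 1))
    (hneg : ∀ v ∈ Set.Ioo (0 : ℝ) 1, w v < 0) : ∫ v in (0 : ℝ)..1, w v * f v < 0 := by
  have hfi : IntervalIntegrable f MeasureTheory.volume 0 1 := by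
    refine intervalIntegrable_deriv_of_nonneg (g := F)
      (fun x _ => (hF x).continuousAt.continuousWithinAt) (fun x _ => hF x) fun x hx => ?_
    rw [min_eq_left zero_le_one, max_eq_right zero_le_one] at hx
    exact (hf x hx).le
  have hwf : IntervalIntegrable (fun v => w v * f v) MeasureTheory.volume 0 1 :=
    hfi.continuousOn_mul (by rwa [Set.uIcc_of_le zero_le_one])
  have hpos : 0 < ∫ v in (0 : ℝ)..1, -(w v * f v) :=
    intervalIntegral_pos_of_pos_on hwf.neg
      (fun v hv => neg_pos.2 (mul_neg_of_neg_of_pos (hneg v hv) (hf v hv))) zero_lt_one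
  rw [intervalIntegral.integral_neg] at hpos
  exact neg_pos.1 hpos

/-- step (2) in the proof of Proposition 3: with
w(v,s) = G(v)·(c'(s − b(v,s))·v − (1 + c'(s − b(v,s))·v)·∂b/∂s), one has
∂w/∂v = G(v)·c'(s − b(v,s))·(1 − ∂b/∂s); if moreover ∂b/∂s < 1 everywhere then
w(·,s) is strictly decreasing on (0,1) and ∫₀¹ w(v,s) dF(v) < 0. -/
theorem stmt_15
    (n : ℕ) (hn : 2 ≤ n)
    (F f : ℝ → ℝ)
    (hF : ∀ v, HasDerivAt F (f v) v)
    (hf : ∀ v ∈ Set.Ioo (0:ℝ) 1, 0 < f v)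
    (hF0 : F 0 = 0)
    (G g : ℝ → ℝ)
    (hG : ∀ v, G v = F v ^ (n - 1))
    (hg : ∀ v, HasDerivAt G (g v) v)
    (c c' c'' : ℝ → ℝ)
    (hc : ∀ t, HasDerivAt c (c' t) t)
    (hcd : ∀ t, HasDerivAt c' (c'' t) t)
    (hc0 : c 0 = 1)
    (hcp : ∀ t, -1 < c' t ∧ c' t < 0)
    (b bv bs bvs : ℝ → ℝ → ℝ)
    (hbv : ∀ v s, HasDerivAt (fun v' => b v' s) (bv v s) v)
    (hbs : ∀ v s, HasDerivAt (fun s' => b v s') (bs v s) s)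
    (hmix1 : ∀ v s, HasDerivAt (fun s' => bv v s') (bvs v s) s)
    (hmix2 : ∀ v s, HasDerivAt (fun v' => bs v' s) (bvs v s) v)
    (hb0 : ∀ s, b 0 s = 0)
    (hODE : ∀ s, ∀ v ∈ Set.Ioc (0:ℝ) 1,
      bv v s = g v / G v * (c (s - b v s) * v - b v s) / (1 + c' (s - b v s) * v)) :
    ∀ s : ℝ,
      (∀ v ∈ Set.Ioc (0:ℝ) 1,
        HasDerivAt
          (fun u => G u * (c' (s - b u s) * u - (1 + c' (s - b u s) * u) * bs u s))
          (G v * c' (s - b v s) * (1 - bs v s)) v)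
      ∧ ((∀ v' s', bs v' s' < 1) →
          StrictAntiOn
            (fun u => G u * (c' (s - b u s) * u - (1 + c' (s - b u s) * u) * bs u s))
            (Set.Ioo 0 1)
          ∧ (∫ v in (0:ℝ)..(1:ℝ),
              G v * (c' (s - b v s) * v - (1 + c' (s - b v s) * v) * bs v s) * f v) < 0) := by
  have hGpos : ∀ v ∈ Set.Ioc (0 : ℝ) 1, 0 < G v := fun v hv => by
    rw [hG]
    exact pow_pos (pos_of_hasDerivAt_pos_of_zero hF hf hF0 hv) _
  have hD : ∀ v ∈ Set.Ioc (0 : ℝ) 1, ∀ t, 0 < 1 + c' t * v := fun v hv t => by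
    nlinarith [hv.1, hv.2, hcp t]
  intro s
  have hcb : ∀ v, HasDerivAt (fun u => c' (s - b u s)) (c'' (s - b v s) * -bv v s) v := fun v =>
    (hcd (s - b v s)).comp v ((hbv v s).const_sub s)
  have hw : ∀ v, HasDerivAt
      (fun u => G u * (c' (s - b u s) * u - (1 + c' (s - b u s) * u) * bs u s)) _ v := fun v =>
    (hg v).mul (((hcb v).mul (hasDerivAt_id v)).sub
      ((((hcb v).mul (hasDerivAt_id v)).const_add 1).mul (hmix2 v s)))
  -- the ODE, with denominators cleared and differentiated in `s`
  have hODEs : ∀ v ∈ Set.Ioc (0 : ℝ) 1,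
      (bvs v s * (1 + c' (s - b v s) * v) + bv v s * (c'' (s - b v s) * (1 - bs v s) * v)) * G v
        = g v * (c' (s - b v s) * (1 - bs v s) * v - bs v s) := fun v hv => by
    have heq : (fun s' => bv v s' * (1 + c' (s' - b v s') * v) * G v)
        = fun s' => g v * (c (s' - b v s') * v - b v s') := by
      funext s'
      have h₁ := (hGpos v hv).ne'
      have h₂ := (hD v hv (s' - b v s')).ne'
      rw [hODE s' v hv, div_mul_cancel₀ _ h₂]
      field_simp
    have hin : HasDerivAt (fun s' => s' - b v s') (1 - bs v s) s :=
      (hasDerivAt_id s).sub (hbs v s)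
    have hl := ((hmix1 v s).mul
      ((((hcd (s - b v s)).comp s hin).mul_const v).const_add 1)).mul_const (G v)
    have hr := ((((hc (s - b v s)).comp s hin).mul_const v).sub (hbs v s)).const_mul (g v)
    exact HasDerivAt.unique (f := fun s' => bv v s' * (1 + c' (s' - b v s') * v) * G v)
      hl (heq ▸ hr)
  have hderiv : ∀ v ∈ Set.Ioc (0 : ℝ) 1, HasDerivAt
      (fun u => G u * (c' (s - b u s) * u - (1 + c' (s - b u s) * u) * bs u s))
      (G v * c' (s - b v s) * (1 - bs v s)) v := fun v hv => by
    refine (hw v).congr_deriv ?_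
    simp only [Pi.mul_apply, id_eq]
    linear_combination -(hODEs v hv)
  refine ⟨hderiv, fun hlt => ?_⟩
  have hcont : ContinuousOn
      (fun u => G u * (c' (s - b u s) * u - (1 + c' (s - b u s) * u) * bs u s))
      (Set.Icc 0 1) := fun v _ => (hw v).continuousAt.continuousWithinAt
  have hanti : StrictAntiOn
      (fun u => G u * (c' (s - b u s) * u - (1 + c' (s - b u s) * u) * bs u s))
      (Set.Icc 0 1) := by
    refine strictAntiOn_of_deriv_neg (convex_Icc 0 1) hcont fun v hv => ?_
    rw [interior_Icc] at hv
    have hv' := Set.Ioo_subset_Ioc_self hv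
    rw [(hderiv v hv').deriv]
    exact mul_neg_of_neg_of_pos (mul_neg_of_pos_of_neg (hGpos v hv') (hcp _).2)
      (sub_pos.2 (hlt v s))
  refine ⟨hanti.mono Set.Ioo_subset_Icc_self, integral_mul_density_neg hF hf hcont fun v hv => ?_⟩
  have hG0 : G 0 = 0 := by rw [hG, hF0, zero_pow (by lia)]
  simpa [hG0] using
    hanti (Set.left_mem_Icc.2 zero_le_one) (Set.Ioo_subset_Icc_self hv) hv.1
end
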